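/- The curvature of the Γ-linear connection ∇ satisfies, for all i, k: R(δ/δx^k, δ/δt) δ/δx^i = Σ_l R^l_{i1k} · δ/δx^l, where R^l_{i1k} := δG^l_i/δx^k − δL^l_{ik}/δt + Σ_r (G^r_i L^l_{rk} − L^r_{ik} G^l_r) + Σ_r C^l_{ir} R^r_{1k}, with R^r_{1k} := δM^r/δx^k − δN^r_k/δt. -/

import Mathlib

noncomputable section
open scoped BigOperators

/-- The local model `E = ℝ × (Fin n → ℝ) × (Fin n → ℝ)` of the 1-jet space `J¹(ℝ,M)`,
with coordinates `(t, x, y)`. -/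
abbrev E (n : ℕ) : Type := ℝ × (Fin n → ℝ) × (Fin n → ℝ)

variable {n : ℕ}

/-- Partial derivative `∂f/∂t`. -/
def pT (f : E n → ℝ) (p : E n) : ℝ := fderiv ℝ f p (1, 0, 0)

/-- Partial derivative `∂f/∂x^i`. -/
def pX (f : E n → ℝ) (i : Fin n) (p : E n) : ℝ := fderiv ℝ f p (0, Pi.single i 1, 0)

/-- Partial derivative `∂f/∂y^i`. -/
def pY (f : E n → ℝ) (i : Fin n) (p : E n) : ℝ := fderiv ℝ f p (0, 0, Pi.single i 1)

/-- The adapted temporal frame field `δ/δt = ∂/∂t - Σ_j M^j ∂/∂y^j`. -/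
def delT (M : E n → Fin n → ℝ) (p : E n) : E n := (1, 0, fun j => -(M p j))

/-- The adapted spatial frame field `δ/δx^i = ∂/∂x^i - Σ_j N^j_i ∂/∂y^j`. -/
def delX (N : E n → Fin n → Fin n → ℝ) (i : Fin n) (p : E n) : E n :=
  (0, Pi.single i 1, fun j => -(N p i j))

/-- The vertical frame field `∂/∂y^i`. -/
def delY (i : Fin n) (p : E n) : E n := ((0 : ℝ), (0 : Fin n → ℝ), Pi.single i 1)

/-- The Lie bracket `[X,Y](p) = (DY)(p)(X(p)) - (DX)(p)(Y(p))` of vector fields on `E`. -/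
def lieBr (X Y : E n → E n) (p : E n) : E n := fderiv ℝ Y p (X p) - fderiv ℝ X p (Y p)

/-- `δf/δt := ∂f/∂t - Σ_k M^k ∂f/∂y^k`. -/
def dT (M : E n → Fin n → ℝ) (f : E n → ℝ) (p : E n) : ℝ :=
  pT f p - ∑ k, M p k * pY f k p

/-- `δf/δx^i := ∂f/∂x^i - Σ_k N^k_i ∂f/∂y^k`. -/
def dX (N : E n → Fin n → Fin n → ℝ) (f : E n → ℝ) (i : Fin n) (p : E n) : ℝ :=
  pX f i p - ∑ k, N p i k * pY f k p

/-- A d-vector field `X = a·δ/δt + Σ_i b^i·δ/δx^i + Σ_i c^i·∂/∂y^i`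
given by its adapted components. -/
structure DVF (n : ℕ) where
  a : E n → ℝ
  b : E n → Fin n → ℝ
  c : E n → Fin n → ℝ

/-- The actual vector field on `E` determined by the adapted components of a `DVF`. -/
def DVF.realize (M : E n → Fin n → ℝ) (N : E n → Fin n → Fin n → ℝ) (X : DVF n)
    (p : E n) : E n :=
  (X.a p, X.b p, fun j => X.c p j - X.a p * M p j - ∑ i, X.b p i * N p i j)

/-- The nine families of adapted coefficients of a Γ-linear connection `∇`:
`Ḡ¹₁₁, G^k_{i1}, G^{(k)(1)}_{(1)(i)1}, L̄¹_{1j}, L^k_{ij}, L^{(k)(1)}_{(1)(i)j},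
C̄^{1(1)}_{1(j)}, C^{k(1)}_{i(j)}, C^{(k)(1)(1)}_{(1)(i)(j)}`. -/
structure Conn (n : ℕ) where
  Gbar : E n → ℝ
  G : E n → Fin n → Fin n → ℝ
  Gv : E n → Fin n → Fin n → ℝ
  Lbar : E n → Fin n → ℝ
  L : E n → Fin n → Fin n → Fin n → ℝ
  Lv : E n → Fin n → Fin n → Fin n → ℝ
  Cbar : E n → Fin n → ℝ
  C : E n → Fin n → Fin n → Fin n → ℝ
  Cv : E n → Fin n → Fin n → Fin n → ℝ

/-- All nine coefficient families are smooth. -/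
def Conn.Smooth (K : Conn n) : Prop :=
  ContDiff ℝ (⊤ : ℕ∞) K.Gbar ∧ ContDiff ℝ (⊤ : ℕ∞) K.G ∧ ContDiff ℝ (⊤ : ℕ∞) K.Gv ∧ ContDiff ℝ (⊤ : ℕ∞) K.Lbar ∧
  ContDiff ℝ (⊤ : ℕ∞) K.L ∧ ContDiff ℝ (⊤ : ℕ∞) K.Lv ∧ ContDiff ℝ (⊤ : ℕ∞) K.Cbar ∧ ContDiff ℝ (⊤ : ℕ∞) K.C ∧
  ContDiff ℝ (⊤ : ℕ∞) K.Cv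

/-- Derivative `X(f)(p) := Df(p)(X(p))` of `f` along the realized vector field of `X`. -/
def Xder (M : E n → Fin n → ℝ) (N : E n → Fin n → Fin n → ℝ) (X : DVF n) (f : E n → ℝ)
    (p : E n) : ℝ := fderiv ℝ f p (X.realize M N p)

/-- The Γ-linear connection `∇_X W` in adapted components. -/
def nabla (M : E n → Fin n → ℝ) (N : E n → Fin n → Fin n → ℝ) (K : Conn n)
    (X W : DVF n) : DVF n where
  a := fun p => Xder M N X W.a p +
    W.a p * (X.a p * K.Gbar p + ∑ j, X.b p j * K.Lbar p j + ∑ j, X.c p j * K.Cbar p j)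
  b := fun p k => Xder M N X (fun q => W.b q k) p +
    ∑ i, W.b p i *
      (X.a p * K.G p k i + ∑ j, X.b p j * K.L p k i j + ∑ j, X.c p j * K.C p k i j)
  c := fun p k => Xder M N X (fun q => W.c q k) p +
    ∑ i, W.c p i *
      (X.a p * K.Gv p k i + ∑ j, X.b p j * K.Lv p k i j + ∑ j, X.c p j * K.Cv p k i j)

/-- The adapted frame field `δ/δt` as a `DVF`. -/
def frT : DVF n := ⟨fun _ => 1, fun _ => 0, fun _ => 0⟩

/-- The adapted frame field `δ/δx^i` as a `DVF`. -/
def frX (i : Fin n) : DVF n := ⟨fun _ => 0, fun _ => Pi.single i 1, fun _ => 0⟩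

/-- The adapted frame field `∂/∂y^i` as a `DVF`. -/
def frY (i : Fin n) : DVF n := ⟨fun _ => 0, fun _ => 0, fun _ => Pi.single i 1⟩

/-- Decomposition of an arbitrary vector field into adapted components. -/
def decomp (M : E n → Fin n → ℝ) (N : E n → Fin n → Fin n → ℝ) (V : E n → E n) : DVF n :=
  ⟨fun p => (V p).1, fun p => (V p).2.1,
   fun p j => (V p).2.2 j + (V p).1 * M p j + ∑ i, (V p).2.1 i * N p i j⟩

/-- The torsion `T(X,Y) := ∇_X Y - ∇_Y X - [X,Y]`. -/
def torsion (M : E n → Fin n → ℝ) (N : E n → Fin n → Fin n → ℝ) (K : Conn n)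
    (X Y : DVF n) (p : E n) : E n :=
  (nabla M N K X Y).realize M N p - (nabla M N K Y X).realize M N p -
    lieBr (X.realize M N) (Y.realize M N) p

/-- The curvature `R(X,Y)Z := ∇_X(∇_Y Z) - ∇_Y(∇_X Z) - ∇_{[X,Y]}Z`. -/
def curv (M : E n → Fin n → ℝ) (N : E n → Fin n → Fin n → ℝ) (K : Conn n)
    (X Y Z : DVF n) (p : E n) : E n :=
  (nabla M N K X (nabla M N K Y Z)).realize M N p -
    (nabla M N K Y (nabla M N K X Z)).realize M N p -
    (nabla M N K (decomp M N (lieBr (X.realize M N) (Y.realize M N))) Z).realize M N p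

theorem continuousLinearMap_eq_sum_vertical (A : E n →L[ℝ] ℝ) (v : Fin n → ℝ) :
    A (0, 0, v) = ∑ k, v k * A (0, 0, Pi.single k 1) := by
  have h : ((0 : ℝ), (0 : Fin n → ℝ), v) =
      ∑ k, v k • ((0 : ℝ), (0 : Fin n → ℝ), (Pi.single k 1 : Fin n → ℝ)) := by
    refine Prod.ext (by simp [Prod.fst_sum]) (Prod.ext (by simp [Prod.fst_sum, Prod.snd_sum]) ?_)
    funext j
    simp [Prod.snd_sum, Finset.sum_apply, Pi.single_apply]
  rw [h, map_sum]
  simp only [map_smul, smul_eq_mul]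

theorem fderiv_apply_delT (M : E n → Fin n → ℝ) (f : E n → ℝ) (p : E n) :
    fderiv ℝ f p (delT M p) = dT M f p := by
  have h : delT M p = ((1, 0, 0) : E n) + (0, 0, fun j => -(M p j)) := by simp [delT]
  rw [h, map_add, continuousLinearMap_eq_sum_vertical]
  simp [dT, pT, pY, sub_eq_add_neg]

theorem fderiv_apply_delX (N : E n → Fin n → Fin n → ℝ) (f : E n → ℝ) (i : Fin n) (p : E n) :
    fderiv ℝ f p (delX N i p) = dX N f i p := by
  have h : delX N i p = ((0, Pi.single i 1, 0) : E n) + (0, 0, fun j => -(N p i j)) := by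
    simp [delX]
  rw [h, map_add, continuousLinearMap_eq_sum_vertical]
  simp [dX, pX, pY, sub_eq_add_neg]

theorem realize_frT (M : E n → Fin n → ℝ) (N : E n → Fin n → Fin n → ℝ) :
    (frT : DVF n).realize M N = delT M := by
  funext p
  simp [DVF.realize, frT, delT]

theorem realize_frX (M : E n → Fin n → ℝ) (N : E n → Fin n → Fin n → ℝ) (i : Fin n) :
    (frX i : DVF n).realize M N = delX N i := by
  funext p
  simp [DVF.realize, frX, delX, Pi.single_apply]

/-- Differentiating a vector field whose horizontal components are constant. -/
theorem fderiv_const_horizontal (a : ℝ) (b : Fin n → ℝ) {F : E n → Fin n → ℝ} {p : E n}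
    (hF : DifferentiableAt ℝ F p) (v : E n) :
    fderiv ℝ (fun q => ((a, b, fun j => -(F q j)) : E n)) p v =
      (0, 0, fun j => -(fderiv ℝ (fun q => F q j) p v)) := by
  have h : HasFDerivAt (fun q => ((a, b, fun j => -(F q j)) : E n)) _ p :=
    (hasFDerivAt_const a p).prodMk ((hasFDerivAt_const b p).prodMk hF.hasFDerivAt.neg)
  rw [h.fderiv, fderiv_pi (fun j => differentiableAt_pi.1 hF j)]
  rfl

theorem lieBr_delX_delT {M : E n → Fin n → ℝ} {N : E n → Fin n → Fin n → ℝ}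
    (hM : Differentiable ℝ M) (hN : Differentiable ℝ N) (k : Fin n) :
    lieBr (delX N k) (delT M) = fun p => (0, 0, fun r =>
      dT M (fun q => N q k r) p - dX N (fun q => M q r) k p) := by
  funext p
  have hT := fderiv_const_horizontal 1 0 (hM p) (delX N k p)
  have hX := fderiv_const_horizontal 0 (Pi.single k 1)
    (differentiableAt_pi.1 (hN p) k) (delT M p)
  simp only [fderiv_apply_delX, fderiv_apply_delT] at hT hX
  have h : lieBr (delX N k) (delT M) p = _ := congrArg₂ (· - ·) hT hX
  rw [h]
  refine Prod.ext (by simp) (Prod.ext (by simp) ?_)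
  funext r
  simp only [Prod.snd_sub, Pi.sub_apply]
  ring

/-- A field with only spatial components, as a combination of the frame `δ/δx^l`. -/
theorem realize_spatial (M : E n → Fin n → ℝ) (N : E n → Fin n → Fin n → ℝ)
    (B : E n → Fin n → ℝ) (p : E n) :
    (⟨fun _ => 0, B, fun _ => 0⟩ : DVF n).realize M N p = ∑ l, B p l • delX N l p := by
  refine Prod.ext (by simp [DVF.realize, delX, Prod.fst_sum]) (Prod.ext ?_ ?_)
  · funext j
    simp [DVF.realize, delX, Prod.fst_sum, Prod.snd_sum, Finset.sum_apply, Pi.single_apply]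
  · funext j
    simp [DVF.realize, delX, Prod.snd_sum, Finset.sum_apply]

theorem nabla_spatial (M : E n → Fin n → ℝ) (N : E n → Fin n → Fin n → ℝ) (K : Conn n)
    (X : DVF n) (B : E n → Fin n → ℝ) :
    nabla M N K X ⟨fun _ => 0, B, fun _ => 0⟩ =
      ⟨fun _ => 0, fun p l => Xder M N X (fun q => B q l) p + ∑ r, B p r *
        (X.a p * K.G p l r + ∑ j, X.b p j * K.L p l r j + ∑ j, X.c p j * K.C p l r j),
        fun _ => 0⟩ := by
  simp only [nabla, Xder, DVF.mk.injEq, true_and]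
  constructor
  · simp
  · funext p l
    simp

theorem nabla_frT_spatial (M : E n → Fin n → ℝ) (N : E n → Fin n → Fin n → ℝ) (K : Conn n)
    (B : E n → Fin n → ℝ) :
    nabla M N K frT ⟨fun _ => 0, B, fun _ => 0⟩ =
      ⟨fun _ => 0, fun p l => dT M (fun q => B q l) p + ∑ r, B p r * K.G p l r,
        fun _ => 0⟩ := by
  simp only [nabla_spatial, Xder, realize_frT, fderiv_apply_delT]
  simp [frT]

theorem nabla_frX_spatial (M : E n → Fin n → ℝ) (N : E n → Fin n → Fin n → ℝ) (K : Conn n)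
    (k : Fin n) (B : E n → Fin n → ℝ) :
    nabla M N K (frX k) ⟨fun _ => 0, B, fun _ => 0⟩ =
      ⟨fun _ => 0, fun p l => dX N (fun q => B q l) k p + ∑ r, B p r * K.L p l r k,
        fun _ => 0⟩ := by
  simp only [nabla_spatial, Xder, realize_frX, fderiv_apply_delX]
  simp [frX, Pi.single_apply]

theorem nabla_frX (M : E n → Fin n → ℝ) (N : E n → Fin n → Fin n → ℝ) (K : Conn n)
    (X : DVF n) (i : Fin n) :
    nabla M N K X (frX i) =
      ⟨fun _ => 0, fun p l =>
        X.a p * K.G p l i + ∑ j, X.b p j * K.L p l i j + ∑ j, X.c p j * K.C p l i j,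
        fun _ => 0⟩ := by
  rw [frX, nabla_spatial]
  simp [Xder, Pi.single_apply]

/-- `R(δ/δx^k, δ/δt) δ/δx^i = Σ_l R^l_{i1k}·δ/δx^l`, where
`R^l_{i1k} := δG^l_i/δx^k − δL^l_{ik}/δt + Σ_r (G^r_i L^l_{rk} − L^r_{ik} G^l_r)
+ Σ_r C^l_{ir} R^r_{1k}` and `R^r_{1k} := δM^r/δx^k − δN^r_k/δt`. -/
theorem curv_delX_delT_delX (n : ℕ) (M : E n → Fin n → ℝ) (N : E n → Fin n → Fin n → ℝ)
    (hM : ContDiff ℝ (⊤ : ℕ∞) M) (hN : ContDiff ℝ (⊤ : ℕ∞) N) (K : Conn n) (hK : K.Smooth) (i k : Fin n) :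
    curv M N K (frX k) frT (frX i) = fun p =>
      ∑ l, (dX N (fun q => K.G q l i) k p - dT M (fun q => K.L q l i k) p
        + (∑ r, (K.G p r i * K.L p l r k - K.L p r i k * K.G p l r))
        + ∑ r, K.C p l i r *
            (dX N (fun q => M q r) k p - dT M (fun q => N q k r) p)) • delX N l p := by
  have hT : nabla M N K frT (frX i) = ⟨fun _ => 0, fun p l => K.G p l i, fun _ => 0⟩ := by
    rw [nabla_frX]
    simp [frT]
  have hX : nabla M N K (frX k) (frX i) = ⟨fun _ => 0, fun p l => K.L p l i k, fun _ => 0⟩ := by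
    rw [nabla_frX]
    simp [frX, Pi.single_apply]
  funext p
  rw [curv, hT, hX, nabla_frX_spatial, nabla_frT_spatial, nabla_frX, realize_frX, realize_frT,
    lieBr_delX_delT (hM.differentiable (by simp)) (hN.differentiable (by simp))]
  simp only [realize_spatial, ← Finset.sum_sub_distrib, ← sub_smul]
  refine Finset.sum_congr rfl fun l _ => congrArg (· • delX N l p) ?_
  have hC : ∑ r, K.C p l i r * (dX N (fun q => M q r) k p - dT M (fun q => N q k r) p) =
      -∑ r, (dT M (fun q => N q k r) p - dX N (fun q => M q r) k p) * K.C p l i r := by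
    rw [← Finset.sum_neg_distrib]
    exact Finset.sum_congr rfl fun r _ => by ring
  rw [hC, Finset.sum_sub_distrib]
  simp [decomp]
  ring
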